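/- arXiv:1806.11500 — 2 statements merged into one kernel-verified Lean document; each statement's English description precedes it below -/
import Mathlib

section
/- Suppose sup_{x ∈ X, a ∈ A} ‖φ(x,a)‖ ≤ B. Then for every context x ∈ X, every action a ∈ A, every w ∈ ℝ^d and every σ > 0: π^sm_w(a|x) · exp(−(1/2) σ B²) ≤ E_{θ ~ N(w, σ I_d)}[ π^sm_θ(a|x) ] ≤ π^sm_w(a|x) · exp(2 σ B²). -/
open MeasureTheory Real

/-- The softmax policy with parameters `θ` and feature map `φ`:
`π^sm_θ(a|x) = exp(θ·φ(x,a)) / ∑_{a'} exp(θ·φ(x,a'))`. -/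
noncomputable def softmax {X : Type*} {k d : ℕ} (φ : X → Fin k → Fin d → ℝ)
    (θ : Fin d → ℝ) (x : X) (a : Fin k) : ℝ :=
  Real.exp (∑ i, θ i * φ x a i) / ∑ a' : Fin k, Real.exp (∑ i, θ i * φ x a' i)

/-- The Gaussian distribution `N(w, σ I_d)` on `ℝ^d`. -/
noncomputable def gaussPi (d : ℕ) (w : Fin d → ℝ) (σ : ℝ) : Measure (Fin d → ℝ) :=
  Measure.pi fun i => ProbabilityTheory.gaussianReal (w i) σ.toNNReal

open ProbabilityTheory

instance gaussPi.instIsProbabilityMeasure (d : ℕ) (w : Fin d → ℝ) (σ : ℝ) :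
    IsProbabilityMeasure (gaussPi d w σ) := by
  unfold gaussPi
  infer_instance

lemma integrable_exp_sum_mul_gaussPi {d : ℕ} (w v : Fin d → ℝ) (σ : ℝ) :
    Integrable (fun θ => Real.exp (∑ i, θ i * v i)) (gaussPi d w σ) := by
  simp_rw [Real.exp_sum]
  refine Integrable.fintype_prod (f := fun i t => Real.exp (t * v i)) fun i => ?_
  simpa only [mul_comm] using integrable_exp_mul_gaussianReal (v i)

lemma integral_exp_sum_mul_gaussPi {d : ℕ} (w v : Fin d → ℝ) {σ : ℝ} (hσ : 0 ≤ σ) :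
    ∫ θ, Real.exp (∑ i, θ i * v i) ∂gaussPi d w σ
      = Real.exp (∑ i, w i * v i + σ * (∑ i, v i ^ 2) / 2) := by
  simp_rw [Real.exp_sum]
  unfold gaussPi
  rw [integral_fintype_prod_eq_prod (f := fun i t => Real.exp (t * v i)), Finset.mul_sum,
    Finset.sum_div, ← Finset.sum_add_distrib, Real.exp_sum]
  refine Finset.prod_congr rfl fun i _ => ?_
  have h := congrFun (mgf_fun_id_gaussianReal (μ := w i) (v := σ.toNNReal)) (v i)
  simpa only [mgf, mul_comm (v i), Real.coe_toNNReal σ hσ] using h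

lemma integrable_eval_gaussPi {d : ℕ} (w : Fin d → ℝ) (σ : ℝ) (i : Fin d) :
    Integrable (fun θ : Fin d → ℝ => θ i) (gaussPi d w σ) := by
  have h : Integrable (fun t : ℝ => t) (gaussianReal (w i) σ.toNNReal) :=
    (memLp_id_gaussianReal 1).integrable le_rfl
  exact (measurePreserving_eval (fun i => gaussianReal (w i) σ.toNNReal)
    i).integrable_comp_of_integrable h

lemma integrable_sum_mul_gaussPi {d : ℕ} (w v : Fin d → ℝ) (σ : ℝ) :
    Integrable (fun θ => ∑ i, θ i * v i) (gaussPi d w σ) :=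
  integrable_finsetSum _ fun i _ => (integrable_eval_gaussPi w σ i).mul_const _

lemma integral_sum_mul_gaussPi {d : ℕ} (w v : Fin d → ℝ) (σ : ℝ) :
    ∫ θ, ∑ i, θ i * v i ∂gaussPi d w σ = ∑ i, w i * v i := by
  rw [integral_finsetSum _ fun i _ => (integrable_eval_gaussPi w σ i).mul_const _]
  refine Finset.sum_congr rfl fun i _ => ?_
  rw [integral_mul_const]
  congr 1
  have h := integral_comp_eval (μ := fun i => gaussianReal (w i) σ.toNNReal) (i := i)
    (f := fun t : ℝ => t) aestronglyMeasurable_id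
  exact h.trans integral_id_gaussianReal

section Pointwise

variable {X : Type*} {k d : ℕ} (φ : X → Fin k → Fin d → ℝ) (θ w : Fin d → ℝ) (x : X) (a : Fin k)

lemma softmax_denom_pos (a : Fin k) : 0 < ∑ b, Real.exp (∑ i, θ i * φ x b i) :=
  Finset.sum_pos (fun _ _ => Real.exp_pos _) ⟨a, Finset.mem_univ a⟩

lemma softmax_nonneg : 0 ≤ softmax φ θ x a :=
  div_nonneg (Real.exp_pos _).le (softmax_denom_pos φ θ x a).le

lemma softmax_le_one : softmax φ θ x a ≤ 1 :=
  div_le_one_of_le₀ (Finset.single_le_sum (f := fun b => Real.exp (∑ i, θ i * φ x b i))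
    (fun _ _ => (Real.exp_pos _).le) (Finset.mem_univ a)) (softmax_denom_pos φ θ x a).le

lemma integrable_softmax_gaussPi (σ : ℝ) :
    Integrable (fun θ => softmax φ θ x a) (gaussPi d w σ) := by
  refine Integrable.of_bound (C := 1) ?_ (ae_of_all _ fun θ => ?_)
  · unfold softmax
    exact Measurable.aestronglyMeasurable (by fun_prop)
  · rw [Real.norm_of_nonneg (softmax_nonneg φ θ x a)]
    exact softmax_le_one φ θ x a

/-- The bound of the reciprocal of a weighted mean by the mean of the reciprocals. -/
lemma softmax_le_sum_exp :
    softmax φ θ x a ≤ ∑ b, Real.exp (2 * ∑ i, w i * φ x b i)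
        / (∑ b, Real.exp (∑ i, w i * φ x b i)) ^ 2
      * Real.exp (∑ i, θ i * (φ x a i - φ x b i)) := by
  have hw := softmax_denom_pos φ w x a
  have hθ := softmax_denom_pos φ θ x a
  have hcs := Finset.sum_sq_le_sum_mul_sum_of_sq_le_mul Finset.univ
    (r := fun b => Real.exp (∑ i, w i * φ x b i)) (f := fun b => Real.exp (∑ i, θ i * φ x b i))
    (g := fun b => Real.exp (2 * ∑ i, w i * φ x b i - ∑ i, θ i * φ x b i))
    (fun _ _ => (Real.exp_pos _).le) (fun _ _ => (Real.exp_pos _).le) fun b _ => by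
      rw [← Real.exp_add, sq, ← Real.exp_add]
      exact (congrArg Real.exp (by ring)).le
  have hsum : ∑ b, Real.exp (2 * ∑ i, w i * φ x b i)
        / (∑ b, Real.exp (∑ i, w i * φ x b i)) ^ 2
      * Real.exp (∑ i, θ i * (φ x a i - φ x b i))
      = Real.exp (∑ i, θ i * φ x a i)
        * (∑ b, Real.exp (2 * ∑ i, w i * φ x b i - ∑ i, θ i * φ x b i))
        / (∑ b, Real.exp (∑ i, w i * φ x b i)) ^ 2 := by
    rw [Finset.mul_sum, Finset.sum_div]
    refine Finset.sum_congr rfl fun b _ => ?_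
    simp_rw [mul_sub, Finset.sum_sub_distrib, Real.exp_sub]
    ring
  rw [hsum, softmax, div_le_div_iff₀ hθ (by positivity), mul_assoc]
  refine mul_le_mul_of_nonneg_left ?_ (Real.exp_pos _).le
  rwa [mul_comm (∑ b, Real.exp (2 * _ - _))]

lemma le_softmax_of_tangent (s : ℝ) :
    softmax φ w x a * Real.exp (-s) * (2 + (∑ i, θ i * φ x a i - ∑ i, w i * φ x a i)
        - Real.exp (-s) / (∑ b, Real.exp (∑ i, w i * φ x b i))
          * ∑ b, Real.exp (∑ i, θ i * φ x b i))
      ≤ softmax φ θ x a := by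
  have hw := softmax_denom_pos φ w x a
  have hθ := softmax_denom_pos φ θ x a
  unfold softmax
  set W := ∑ b, Real.exp (∑ i, w i * φ x b i)
  set T := ∑ b, Real.exp (∑ i, θ i * φ x b i)
  set u := ∑ i, θ i * φ x a i
  set v := ∑ i, w i * φ x a i
  have hY : 0 < Real.exp (-s) / W * T := by positivity
  have hlog := Real.log_le_sub_one_of_pos hY
  have hexp := Real.add_one_le_exp (u - v - Real.log (Real.exp (-s) / W * T))
  rw [Real.exp_sub, Real.exp_log hY] at hexp
  calc Real.exp v / W * Real.exp (-s) * (2 + (u - v) - Real.exp (-s) / W * T)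
      ≤ Real.exp v / W * Real.exp (-s) * (Real.exp (u - v) / (Real.exp (-s) / W * T)) := by
        gcongr
        linarith
    _ = Real.exp u / T := by
        rw [Real.exp_sub]
        field_simp

end Pointwise

lemma sum_sub_sq_le {d : ℕ} {p q : Fin d → ℝ} {C : ℝ}
    (hp : ∑ i, p i ^ 2 ≤ C) (hq : ∑ i, q i ^ 2 ≤ C) : ∑ i, (p i - q i) ^ 2 ≤ 4 * C := by
  have h : ∑ i, (p i - q i) ^ 2 ≤ ∑ i, (2 * p i ^ 2 + 2 * q i ^ 2) :=
    Finset.sum_le_sum fun i _ => by nlinarith [sq_nonneg (p i + q i)]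
  rw [Finset.sum_add_distrib, ← Finset.mul_sum, ← Finset.mul_sum] at h
  linarith

/-- **Mixed-logit action-probability bounds (Lemma 5).** If `‖φ(x,a)‖ ≤ B` for all `x, a`, then
`π^sm_w(a|x) e^{-σB²/2} ≤ E_{θ~N(w,σI)}[π^sm_θ(a|x)] ≤ π^sm_w(a|x) e^{2σB²}`. -/
theorem mixed_logit_mean_bounds
    {X : Type*} {k d : ℕ} (φ : X → Fin k → Fin d → ℝ) (B : ℝ)
    (hB : ∀ x a, Real.sqrt (∑ i, (φ x a i) ^ 2) ≤ B)
    (x : X) (a : Fin k) (w : Fin d → ℝ) (σ : ℝ) (hσ : 0 < σ) :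
    softmax φ w x a * Real.exp (-(1 / 2) * σ * B ^ 2)
        ≤ ∫ θ, softmax φ θ x a ∂gaussPi d w σ ∧
      (∫ θ, softmax φ θ x a ∂gaussPi d w σ)
        ≤ softmax φ w x a * Real.exp (2 * σ * B ^ 2) := by
  have hsq : ∀ b, ∑ i, φ x b i ^ 2 ≤ B ^ 2 := fun b => (Real.sqrt_le_iff.mp (hB x b)).2
  have hW := softmax_denom_pos φ w x a
  have hint := integrable_softmax_gaussPi φ w x a σ
  constructor
  · set s := 1 / 2 * σ * B ^ 2 with hs
    have hs' : -(1 / 2) * σ * B ^ 2 = -s := by rw [hs]; ring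
    rw [hs']
    have hZint : Integrable (fun θ => ∑ b, Real.exp (∑ i, θ i * φ x b i)) (gaussPi d w σ) :=
      integrable_finsetSum _ fun b _ => integrable_exp_sum_mul_gaussPi w (φ x b) σ
    have hZ : ∫ θ, ∑ b, Real.exp (∑ i, θ i * φ x b i) ∂gaussPi d w σ
        ≤ (∑ b, Real.exp (∑ i, w i * φ x b i)) * Real.exp s := by
      rw [integral_finsetSum _ fun b _ => integrable_exp_sum_mul_gaussPi w (φ x b) σ,
        Finset.sum_mul]
      refine Finset.sum_le_sum fun b _ => ?_
      rw [integral_exp_sum_mul_gaussPi w (φ x b) hσ.le, ← Real.exp_add]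
      gcongr
      nlinarith [hsq b]
    have hu : Integrable (fun θ => ∑ i, θ i * φ x a i - ∑ i, w i * φ x a i) (gaussPi d w σ) :=
      (integrable_sum_mul_gaussPi w (φ x a) σ).sub (integrable_const _)
    have hlin : Integrable (fun θ => 2 + (∑ i, θ i * φ x a i - ∑ i, w i * φ x a i))
        (gaussPi d w σ) :=
      (integrable_const _).add hu
    have hmono := integral_mono ((hlin.sub (hZint.const_mul _)).const_mul _) hint
      fun θ => le_softmax_of_tangent φ θ w x a s
    refine le_trans ?_ hmono
    simp only [Pi.sub_apply]
    rw [integral_const_mul, integral_sub hlin (hZint.const_mul _), integral_const_mul,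
      integral_add (integrable_const _) hu,
      integral_sub (integrable_sum_mul_gaussPi w (φ x a) σ) (integrable_const _),
      integral_sum_mul_gaussPi]
    simp only [integral_const, probReal_univ, one_smul, sub_self, add_zero]
    refine le_mul_of_one_le_right (mul_nonneg (softmax_nonneg φ w x a) (Real.exp_pos _).le) ?_
    have hone := mul_le_mul_of_nonneg_left hZ (div_pos (Real.exp_pos (-s)) hW).le
    rw [← mul_assoc, div_mul_cancel₀ _ hW.ne', ← Real.exp_add, neg_add_cancel, Real.exp_zero]
      at hone
    linarith
  · have hterm : ∀ b, Integrable (fun θ => Real.exp (2 * ∑ i, w i * φ x b i)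
        / (∑ b, Real.exp (∑ i, w i * φ x b i)) ^ 2
        * Real.exp (∑ i, θ i * (φ x a i - φ x b i))) (gaussPi d w σ) := fun b =>
      (integrable_exp_sum_mul_gaussPi w (fun i => φ x a i - φ x b i) σ).const_mul _
    refine (integral_mono hint (integrable_finsetSum _ fun b _ => hterm b)
      fun θ => softmax_le_sum_exp φ θ w x a).trans ?_
    rw [integral_finsetSum _ fun b _ => hterm b]
    have hfactor : softmax φ w x a * Real.exp (2 * σ * B ^ 2)
        = ∑ b, Real.exp (2 * ∑ i, w i * φ x b i) / (∑ b, Real.exp (∑ i, w i * φ x b i)) ^ 2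
          * Real.exp (∑ i, w i * (φ x a i - φ x b i) + 2 * σ * B ^ 2) := by
      have hb : ∀ b, Real.exp (2 * ∑ i, w i * φ x b i)
            / (∑ b, Real.exp (∑ i, w i * φ x b i)) ^ 2
            * Real.exp (∑ i, w i * (φ x a i - φ x b i) + 2 * σ * B ^ 2)
          = Real.exp (∑ i, w i * φ x b i) * (Real.exp (∑ i, w i * φ x a i)
            * Real.exp (2 * σ * B ^ 2) / (∑ b, Real.exp (∑ i, w i * φ x b i)) ^ 2) := fun b => by
        simp_rw [mul_sub, Finset.sum_sub_distrib]
        rw [two_mul, Real.exp_add, Real.exp_add, Real.exp_sub]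
        field_simp
      rw [Finset.sum_congr rfl fun b _ => hb b, ← Finset.sum_mul, softmax]
      field_simp
    rw [hfactor]
    refine Finset.sum_le_sum fun b _ => ?_
    rw [integral_const_mul, integral_exp_sum_mul_gaussPi w (fun i => φ x a i - φ x b i) hσ.le]
    gcongr
    nlinarith [sum_sub_sq_le (hsq a) (hsq b)]
end

section
/- Let ℓ : ℝ^d × Z → ℝ≥0 be a loss function that is convex and L-Lipschitz with respect to its first argument, λ > 0, and for a dataset S ∈ Z^n let θ̂_S be the minimizer of F_S(θ) = (1/n) Σ_{i=1}^n ℓ(θ, z_i) + λ‖θ‖². Let D be a probability distribution on Z and θ̄ = E_{S~D^n}[θ̂_S]. Then for any δ ∈ (0,1), with probability at least 1 − δ over i.i.d. draws S ~ D^n, ‖θ̂_S − θ̄‖ < (L/λ) sqrt(2 ln(2/δ) / n). -/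
open MeasureTheory Real

/-- The function `y ↦ cosh √y` is convex and nondecreasing on `[0, ∞)`, stated in terms of square
roots. -/
lemma cosh_le_of_sq_le_convexCombination {p q u v w : ℝ} (hp : 0 ≤ p) (hq : 0 ≤ q)
    (hpq : p + q = 1) (h : w ^ 2 ≤ p * u ^ 2 + q * v ^ 2) :
    cosh w ≤ p * cosh u + q * cosh v := by
  refine hasSum_le (fun k => ?_) w.hasSum_cosh
    ((u.hasSum_cosh.mul_left p).add (v.hasSum_cosh.mul_left q))
  have hpow : w ^ (2 * k) ≤ p * u ^ (2 * k) + q * v ^ (2 * k) := by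
    simp only [pow_mul]
    calc (w ^ 2) ^ k ≤ (p * u ^ 2 + q * v ^ 2) ^ k := by gcongr
      _ ≤ p * (u ^ 2) ^ k + q * (v ^ 2) ^ k :=
        (convexOn_pow k).2 (Set.mem_Ici.2 (sq_nonneg u)) (Set.mem_Ici.2 (sq_nonneg v)) hp hq hpq
  calc w ^ (2 * k) / ((2 * k).factorial : ℝ)
      ≤ (p * u ^ (2 * k) + q * v ^ (2 * k)) / ((2 * k).factorial : ℝ) := by gcongr
    _ = _ := by ring

lemma norm_regularizedMinimizer_le {E Z : Type*} [NormedAddCommGroup E] {n : ℕ}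
    {l : E → Z → ℝ} {L lam : ℝ} {h : (Fin n → Z) → E} (hn : 1 ≤ n) (hL : 0 < L) (hlam : 0 < lam)
    (hlip : ∀ z x y, |l x z - l y z| ≤ L * ‖x - y‖)
    (hmin : ∀ S x, (1 / (n : ℝ)) * ∑ i, l (h S) (S i) + lam * ‖h S‖ ^ 2
      ≤ (1 / (n : ℝ)) * ∑ i, l x (S i) + lam * ‖x‖ ^ 2) (S : Fin n → Z) :
    ‖h S‖ ≤ L / lam := by
  have hn0 : (0 : ℝ) < n := by exact_mod_cast hn
  have hzero := hmin S 0
  have hsum : ∑ i, l 0 (S i) - ∑ i, l (h S) (S i) ≤ n * (L * ‖h S‖) := by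
    rw [← Finset.sum_sub_distrib]
    calc ∑ i, (l 0 (S i) - l (h S) (S i)) ≤ ∑ _i : Fin n, L * ‖h S‖ :=
          Finset.sum_le_sum fun i _ => (le_abs_self _).trans (by simpa using hlip (S i) 0 (h S))
      _ = n * (L * ‖h S‖) := by simp
  have hsq : lam * ‖h S‖ ^ 2 ≤ L * ‖h S‖ := by
    have : (1 / (n : ℝ)) * (∑ i, l 0 (S i) - ∑ i, l (h S) (S i)) ≤ L * ‖h S‖ := by
      rw [one_div, inv_mul_le_iff₀ hn0]
      exact hsum
    rw [norm_zero] at hzero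
    linarith
  rw [le_div_iff₀ hlam]
  rcases (norm_nonneg (h S)).eq_or_lt with h0 | h0
  · rw [← h0]
    linarith
  · nlinarith

section Hilbert

variable {E : Type*} [NormedAddCommGroup E] [InnerProductSpace ℝ E]

lemma cosh_norm_add_le {x y : E} {c : ℝ} (hc : 0 < c) (hy : ‖y‖ ≤ c) :
    cosh ‖x + y‖ ≤ cosh ‖x‖ * cosh c + inner ℝ x y * (sinh ‖x‖ * sinh c / (‖x‖ * c)) := by
  rcases eq_or_ne x 0 with rfl | hx
  · simpa [cosh_le_cosh, abs_of_pos hc] using hy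
  have hx' : 0 < ‖x‖ := norm_pos_iff.2 hx
  have hac : 0 < ‖x‖ * c := mul_pos hx' hc
  have hin : |inner ℝ x y| ≤ ‖x‖ * c :=
    (abs_real_inner_le_norm x y).trans (by gcongr)
  obtain ⟨t, ht⟩ : ∃ t, t = inner ℝ x y / (‖x‖ * c) := ⟨_, rfl⟩
  have hinner : inner ℝ x y = t * (‖x‖ * c) := by rw [ht]; field_simp
  have ht1 : |t| ≤ 1 := by
    rw [ht, abs_div, abs_of_pos hac]
    exact div_le_one_of_le₀ hin hac.le
  obtain ⟨hl, hu⟩ := abs_le.1 ht1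
  have key := cosh_le_of_sq_le_convexCombination (p := (1 + t) / 2) (q := (1 - t) / 2)
    (u := ‖x‖ + c) (v := ‖x‖ - c) (w := ‖x + y‖) (by linarith) (by linarith) (by ring) (by
      rw [norm_add_sq_real, hinner]
      have : ‖y‖ ^ 2 ≤ c ^ 2 := by gcongr
      nlinarith)
  refine key.trans_eq ?_
  rw [cosh_add, cosh_sub, hinner]
  field_simp
  ring

/-- Quadratic growth of a Tikhonov-regularized convex function around its minimizer. -/
lemma ConvexOn.mul_norm_sub_sq_le_of_isMinimizer {G : E → ℝ} (hG : ConvexOn ℝ Set.univ G)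
    {lam : ℝ} {x : E}
    (hx : ∀ y, G x + lam * ‖x‖ ^ 2 ≤ G y + lam * ‖y‖ ^ 2) (y : E) :
    lam * ‖y - x‖ ^ 2 ≤ (G y + lam * ‖y‖ ^ 2) - (G x + lam * ‖x‖ ^ 2) := by
  have hseg : ∀ t ∈ Set.Ioo (0 : ℝ) 1,
      (1 - t) * (lam * ‖y - x‖ ^ 2) ≤ (G y + lam * ‖y‖ ^ 2) - (G x + lam * ‖x‖ ^ 2) := by
    rintro t ⟨ht0, ht1⟩
    have hmin := hx ((1 - t) • x + t • y)
    have hcvx := hG.2 (Set.mem_univ x) (Set.mem_univ y) (sub_nonneg.2 ht1.le) ht0.le (by ring)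
    have hnorm : ‖(1 - t) • x + t • y‖ ^ 2
        = (1 - t) * ‖x‖ ^ 2 + t * ‖y‖ ^ 2 - t * (1 - t) * ‖y - x‖ ^ 2 := by
      rw [norm_add_sq_real, norm_sub_sq_real, norm_smul, norm_smul, real_inner_smul_left,
        real_inner_smul_right, real_inner_comm, mul_pow, mul_pow, norm_eq_abs, norm_eq_abs,
        sq_abs, sq_abs]
      ring
    rw [hnorm] at hmin
    simp only [smul_eq_mul] at hcvx
    refine le_of_mul_le_mul_left ?_ ht0
    linarith
  have hlim : Filter.Tendsto (fun t : ℝ => (1 - t) * (lam * ‖y - x‖ ^ 2))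
      (nhdsWithin 0 (Set.Ioi 0)) (nhds (lam * ‖y - x‖ ^ 2)) := by
    have hcont : Continuous fun t : ℝ => (1 - t) * (lam * ‖y - x‖ ^ 2) := by fun_prop
    simpa using (hcont.tendsto 0).mono_left nhdsWithin_le_nhds
  refine le_of_tendsto hlim ?_
  filter_upwards [Ioo_mem_nhdsGT (zero_lt_one' ℝ)] with t ht using hseg t ht

/-- Uniform stability of regularized empirical risk minimization under replacement of one
sample. -/
lemma norm_regularizedMinimizer_sub_le {Z : Type*} {n : ℕ} {l : E → Z → ℝ} {L lam : ℝ}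
    {h : (Fin n → Z) → E} (hn : 1 ≤ n) (hL : 0 < L) (hlam : 0 < lam)
    (hconv : ∀ z, ConvexOn ℝ Set.univ fun x => l x z)
    (hlip : ∀ z x y, |l x z - l y z| ≤ L * ‖x - y‖)
    (hmin : ∀ S x, (1 / (n : ℝ)) * ∑ i, l (h S) (S i) + lam * ‖h S‖ ^ 2
      ≤ (1 / (n : ℝ)) * ∑ i, l x (S i) + lam * ‖x‖ ^ 2)
    (S S' : Fin n → Z) (i : Fin n) (hS : ∀ j, j ≠ i → S j = S' j) :
    ‖h S - h S'‖ ≤ L / (lam * n) := by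
  have hn0 : (0 : ℝ) < n := by exact_mod_cast hn
  have hcvx : ∀ S : Fin n → Z,
      ConvexOn ℝ Set.univ fun x => (1 / (n : ℝ)) * ∑ i, l x (S i) := fun S => by
    refine ⟨convex_univ, fun x _ y _ a b ha hb hab => ?_⟩
    have hsum : ∑ i, l (a • x + b • y) (S i) ≤ ∑ i, (a * l x (S i) + b * l y (S i)) :=
      Finset.sum_le_sum fun i _ => (hconv (S i)).2 (Set.mem_univ x) (Set.mem_univ y) ha hb hab
    rw [Finset.sum_add_distrib, ← Finset.mul_sum, ← Finset.mul_sum] at hsum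
    calc (1 / (n : ℝ)) * ∑ i, l (a • x + b • y) (S i)
        ≤ (1 / (n : ℝ)) * (a * ∑ i, l x (S i) + b * ∑ i, l y (S i)) := by gcongr
      _ = _ := by simp only [smul_eq_mul]; ring
  have h1 := (hcvx S).mul_norm_sub_sq_le_of_isMinimizer (hmin S) (h S')
  have h2 := (hcvx S').mul_norm_sub_sq_le_of_isMinimizer (hmin S') (h S)
  rw [norm_sub_rev] at h1
  have hsplit : ∀ x, ∑ j, l x (S j) - ∑ j, l x (S' j) = l x (S i) - l x (S' i) := fun x => by
    rw [← Finset.sum_sub_distrib]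
    exact Finset.sum_eq_single i (fun j _ hj => by rw [hS j hj, sub_self]) (by simp)
  have hb1 := (le_abs_self _).trans (hlip (S i) (h S') (h S))
  have hb2 := (le_abs_self _).trans (hlip (S' i) (h S) (h S'))
  rw [norm_sub_rev] at hb1
  have hsq : 2 * (lam * ‖h S - h S'‖ ^ 2) ≤ (1 / (n : ℝ)) * (2 * (L * ‖h S - h S'‖)) := by
    have hx := hsplit (h S)
    have hy := hsplit (h S')
    calc 2 * (lam * ‖h S - h S'‖ ^ 2)
        ≤ (1 / (n : ℝ)) * ((∑ j, l (h S') (S j) - ∑ j, l (h S') (S' j))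
            - (∑ j, l (h S) (S j) - ∑ j, l (h S) (S' j))) := by linarith
      _ ≤ _ := by
        rw [hx, hy]
        gcongr
        linarith
  have hsq' : lam * n * ‖h S - h S'‖ ^ 2 ≤ L * ‖h S - h S'‖ := by
    rw [one_div, le_inv_mul_iff₀ hn0] at hsq
    linarith
  rw [le_div_iff₀ (by positivity)]
  rcases (norm_nonneg (h S - h S')).eq_or_lt with h0 | h0
  · rw [← h0]
    linarith
  · nlinarith

variable [CompleteSpace E]

lemma integral_cosh_norm_add_le {Ω : Type*} [MeasurableSpace Ω] {μ : Measure Ω}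
    [IsProbabilityMeasure μ] {X : Ω → E} (hX : StronglyMeasurable X) {c : ℝ} (hc : 0 < c)
    (hXc : ∀ ω, ‖X ω‖ ≤ c) (hmean : ∫ ω, X ω ∂μ = 0) (x : E) :
    ∫ ω, cosh ‖x + X ω‖ ∂μ ≤ cosh ‖x‖ * exp (c ^ 2 / 2) := by
  have hXi : Integrable X μ := .of_bound hX.aestronglyMeasurable c (.of_forall hXc)
  have hinner : Integrable (fun ω => inner ℝ x (X ω)) μ := hXi.const_inner x
  have hright : Integrable (fun ω => cosh ‖x‖ * cosh c
      + inner ℝ x (X ω) * (sinh ‖x‖ * sinh c / (‖x‖ * c))) μ :=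
    (integrable_const _).add (hinner.mul_const _)
  calc ∫ ω, cosh ‖x + X ω‖ ∂μ
      ≤ ∫ ω, (cosh ‖x‖ * cosh c + inner ℝ x (X ω) * (sinh ‖x‖ * sinh c / (‖x‖ * c))) ∂μ :=
        integral_mono_of_nonneg (.of_forall fun ω => (cosh_pos _).le) hright
          (.of_forall fun ω => cosh_norm_add_le hc (hXc ω))
    _ = cosh ‖x‖ * cosh c := by
        rw [integral_add (integrable_const _) (hinner.mul_const _),
          integral_mul_const (sinh ‖x‖ * sinh c / (‖x‖ * c)), integral_inner hXi, hmean]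
        simp
    _ ≤ cosh ‖x‖ * exp (c ^ 2 / 2) := by
        gcongr
        exact cosh_le_exp_half_sq c

/-- A Hilbert-space version of the exponential-moment bound behind McDiarmid's inequality. -/
lemma integral_cosh_norm_add_sub_integral_le {Z : Type*} [MeasurableSpace Z] (D : Measure Z)
    [IsProbabilityMeasure D] {c B : ℝ} (hc : 0 < c) {n : ℕ} {f : (Fin n → Z) → E}
    (hf : StronglyMeasurable f) (hB : ∀ S, ‖f S‖ ≤ B)
    (hdiff : ∀ S S' i, (∀ j, j ≠ i → S j = S' j) → ‖f S - f S'‖ ≤ c) (x : E) :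
    ∫ S, cosh ‖x + (f S - ∫ S', f S' ∂(Measure.pi fun _ : Fin n => D))‖
        ∂(Measure.pi fun _ : Fin n => D)
      ≤ cosh ‖x‖ * exp (n * (c ^ 2 / 2)) := by
  induction n generalizing x with
  | zero =>
    have hconst : ∀ S, f S = f default := fun S => congrArg f (Subsingleton.elim _ _)
    simp [hconst]
  | succ n ih =>
    let P : Measure (Fin n → Z) := Measure.pi fun _ => D
    let e := MeasurableEquiv.piFinSuccAbove (fun _ : Fin (n + 1) => Z) 0
    have he : MeasurePreserving e.symm (D.prod P) (Measure.pi fun _ => D) :=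
      (measurePreserving_piFinSuccAbove (fun _ : Fin (n + 1) => D) 0).symm
    have heq : ∀ z w, e.symm (z, w) = Fin.cons z w := fun z w => by
      simp [e, MeasurableEquiv.piFinSuccAbove, Fin.insertNthEquiv]
    let g : Z × (Fin n → Z) → E := fun p => f (e.symm p)
    have hg : StronglyMeasurable g := hf.comp_measurable e.symm.measurable
    have hgi : Integrable g (D.prod P) :=
      .of_bound hg.aestronglyMeasurable B (.of_forall fun p => hB _)
    let m : Z → E := fun z => ∫ w, g (z, w) ∂P
    let M : E := ∫ z, m z ∂D
    have hm : StronglyMeasurable m := hg.integral_prod_right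
    have hsec : ∀ z, StronglyMeasurable fun w => g (z, w) := fun z =>
      hg.comp_measurable measurable_prodMk_left
    have hseci : ∀ z, Integrable (fun w => g (z, w)) P := fun z =>
      .of_bound (hsec z).aestronglyMeasurable B (.of_forall fun w => hB _)
    have hM : ∫ S, f S ∂(Measure.pi fun _ : Fin (n + 1) => D) = M := by
      rw [← he.integral_comp' f]
      exact integral_prod g hgi
    have hmB : ∀ z, ‖m z‖ ≤ B := fun z => by
      simpa using norm_integral_le_of_norm_le_const (μ := P) (f := fun w => g (z, w))
        (.of_forall fun w => hB _)
    have hmi : Integrable m D := .of_bound hm.aestronglyMeasurable B (.of_forall hmB)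
    have hmm : ∀ z z', ‖m z - m z'‖ ≤ c := fun z z' => by
      rw [← integral_sub (hseci z) (hseci z')]
      simpa using norm_integral_le_of_norm_le_const (μ := P)
        (f := fun w => g (z, w) - g (z', w)) (.of_forall fun w => hdiff _ _ 0 fun j hj => by
          obtain ⟨k, rfl⟩ := Fin.exists_succ_eq.2 hj
          simp [heq])
    have hmM : ∀ z, ‖m z - M‖ ≤ c := fun z => by
      have hsub : m z - M = ∫ z', (m z - m z') ∂D := by
        rw [integral_sub (integrable_const _) hmi]
        simp [M]
      rw [hsub]
      simpa using norm_integral_le_of_norm_le_const (μ := D) (.of_forall (hmm z))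
    have hmean : ∫ z, (m z - M) ∂D = 0 := by
      rw [integral_sub hmi (integrable_const _)]
      simp [M]
    have hMB : ‖M‖ ≤ B := by
      simpa using norm_integral_le_of_norm_le_const (μ := D) (.of_forall hmB)
    have hFi : Integrable (fun p => cosh ‖x + (g p - M)‖) (D.prod P) := by
      refine .of_bound (C := cosh (‖x‖ + (B + B))) ?_ (.of_forall fun p => ?_)
      · exact (continuous_cosh.comp_stronglyMeasurable
          (stronglyMeasurable_const.add (hg.sub stronglyMeasurable_const)).norm).aestronglyMeasurable
      · rw [norm_of_nonneg (cosh_pos _).le, cosh_le_cosh, abs_of_nonneg (norm_nonneg _)]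
        refine le_trans ?_ (le_abs_self _)
        refine (norm_add_le _ _).trans ?_
        gcongr
        exact (norm_sub_le _ _).trans (add_le_add (hB _) hMB)
    have hinner : ∀ z, ∫ w, cosh ‖x + (g (z, w) - M)‖ ∂P
        ≤ cosh ‖x + (m z - M)‖ * exp (n * (c ^ 2 / 2)) := fun z => by
      have := ih (f := fun w => g (z, w)) (hsec z) (fun w => hB _)
        (fun w w' i hw => hdiff _ _ i.succ fun j hj => by
          rw [heq, heq]
          rcases Fin.eq_zero_or_eq_succ j with rfl | ⟨k, rfl⟩
          · simp
          · simpa using hw k fun h => hj (h ▸ rfl)) (x + (m z - M))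
      refine le_trans (le_of_eq ?_) this
      refine integral_congr_ae (.of_forall fun w => ?_)
      change cosh ‖x + (g (z, w) - M)‖ = cosh ‖x + (m z - M) + (g (z, w) - m z)‖
      congr 2
      abel
    have hci : Integrable (fun z => cosh ‖x + (m z - M)‖) D := by
      refine .of_bound (C := cosh (‖x‖ + c)) ?_ (.of_forall fun z => ?_)
      · exact (continuous_cosh.comp_stronglyMeasurable
          (stronglyMeasurable_const.add (hm.sub stronglyMeasurable_const)).norm).aestronglyMeasurable
      · rw [norm_of_nonneg (cosh_pos _).le, cosh_le_cosh, abs_of_nonneg (norm_nonneg _)]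
        refine le_trans ?_ (le_abs_self _)
        exact (norm_add_le _ _).trans (by gcongr; exact hmM z)
    rw [hM, ← he.integral_comp' fun S => cosh ‖x + (f S - M)‖]
    calc ∫ p, cosh ‖x + (g p - M)‖ ∂(D.prod P)
        = ∫ z, ∫ w, cosh ‖x + (g (z, w) - M)‖ ∂P ∂D := integral_prod _ hFi
      _ ≤ ∫ z, cosh ‖x + (m z - M)‖ * exp (n * (c ^ 2 / 2)) ∂D :=
          integral_mono hFi.integral_prod_left (hci.mul_const _) hinner
      _ = (∫ z, cosh ‖x + (m z - M)‖ ∂D) * exp (n * (c ^ 2 / 2)) := integral_mul_const _ _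
      _ ≤ (cosh ‖x‖ * exp (c ^ 2 / 2)) * exp (n * (c ^ 2 / 2)) := by
          gcongr
          exact integral_cosh_norm_add_le (hm.sub stronglyMeasurable_const) hc hmM hmean x
      _ = cosh ‖x‖ * exp ((n + 1 : ℕ) * (c ^ 2 / 2)) := by
          rw [mul_assoc, ← exp_add]
          congr 2
          push_cast
          ring

/-- **McDiarmid's inequality in a Hilbert space**, with the constant of Pinelis. -/
lemma measureReal_norm_sub_integral_ge_le {Z : Type*} [MeasurableSpace Z] (D : Measure Z)
    [IsProbabilityMeasure D] {c B : ℝ} (hc : 0 < c) {n : ℕ} (hn : 1 ≤ n) {f : (Fin n → Z) → E}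
    (hf : StronglyMeasurable f) (hB : ∀ S, ‖f S‖ ≤ B)
    (hdiff : ∀ S S' i, (∀ j, j ≠ i → S j = S' j) → ‖f S - f S'‖ ≤ c) {r : ℝ} (hr : 0 < r) :
    (Measure.pi fun _ : Fin n => D).real
        {S | r ≤ ‖f S - ∫ S', f S' ∂(Measure.pi fun _ : Fin n => D)‖}
      ≤ 2 * exp (-r ^ 2 / (2 * n * c ^ 2)) := by
  let P : Measure (Fin n → Z) := Measure.pi fun _ => D
  have hn0 : (0 : ℝ) < n := by exact_mod_cast hn
  let s : ℝ := r / (n * c ^ 2)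
  have hs : 0 < s := by positivity
  let M : E := ∫ S, f S ∂P
  have hscale : ∫ S, s • f S ∂P = s • M := integral_smul s f
  have hMB : ‖M‖ ≤ B := by
    simpa using norm_integral_le_of_norm_le_const (μ := P) (.of_forall hB)
  have hmgf : ∫ S, cosh (s * ‖f S - M‖) ∂P ≤ exp (n * ((s * c) ^ 2 / 2)) := by
    have := integral_cosh_norm_add_sub_integral_le D (c := s * c) (B := s * B) (by positivity)
      (f := fun S => s • f S) (hf.const_smul s)
      (fun S => by rw [norm_smul, norm_of_nonneg hs.le]; gcongr; exact hB S)
      (fun S S' i h => by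
        rw [← smul_sub, norm_smul, norm_of_nonneg hs.le]; gcongr; exact hdiff S S' i h) 0
    change ∫ S, cosh ‖0 + (s • f S - ∫ S', s • f S' ∂P)‖ ∂P ≤ _ at this
    simpa [hscale, ← smul_sub, norm_smul, abs_of_pos hs] using this
  have hint : Integrable (fun S => cosh (s * ‖f S - M‖)) P := by
    refine .of_bound (C := cosh (s * (B + B))) ?_ (.of_forall fun S => ?_)
    · exact (continuous_cosh.comp_stronglyMeasurable
        ((hf.sub stronglyMeasurable_const).norm.const_mul s)).aestronglyMeasurable
    · rw [norm_of_nonneg (cosh_pos _).le, cosh_le_cosh, abs_of_nonneg (by positivity)]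
      refine le_trans ?_ (le_abs_self _)
      gcongr
      exact (norm_sub_le _ _).trans (add_le_add (hB _) hMB)
  have hmarkov := mul_meas_ge_le_integral_of_nonneg
    (.of_forall fun S => (cosh_pos (s * ‖f S - M‖)).le) hint (cosh (s * r))
  have hset : {S | r ≤ ‖f S - M‖} = {S | cosh (s * r) ≤ cosh (s * ‖f S - M‖)} := by
    ext S
    rw [Set.mem_ofPred_eq, Set.mem_ofPred_eq, cosh_le_cosh, abs_of_nonneg (by positivity),
      abs_of_nonneg (by positivity), mul_le_mul_iff_right₀ hs]
  change P.real {S | r ≤ ‖f S - M‖} ≤ _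
  rw [hset]
  have hexp : exp (s * r) / 2 ≤ cosh (s * r) := by
    rw [cosh_eq]
    linarith [exp_pos (-(s * r))]
  have hle : exp (s * r) / 2 * P.real {S | cosh (s * r) ≤ cosh (s * ‖f S - M‖)}
      ≤ exp (n * ((s * c) ^ 2 / 2)) :=
    (mul_le_mul_of_nonneg_right hexp measureReal_nonneg).trans (hmarkov.trans hmgf)
  have hexponent : -r ^ 2 / (2 * n * c ^ 2) = n * ((s * c) ^ 2 / 2) - s * r := by
    simp only [s]
    field_simp
    ring
  rw [hexponent, exp_sub, ← mul_div_assoc, le_div_iff₀ (exp_pos _)]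
  linarith

end Hilbert

/-- **Concentration of the regularized empirical risk minimizer (Lemma 13).**
If `ℓ` is convex and `L`-Lipschitz in its first argument and `θ̂_S` minimizes
`F_S(θ) = (1/n) ∑ᵢ ℓ(θ, zᵢ) + λ‖θ‖²`, then with probability at least `1 - δ` over
`S ~ D^n`, `‖θ̂_S - E[θ̂]‖ < (L/λ) sqrt(2 ln(2/δ)/n)`. -/
theorem rerm_concentration
    {Z : Type*} [MeasurableSpace Z] {d n : ℕ} (hn : 1 ≤ n)
    (D : Measure Z) [IsProbabilityMeasure D]
    (ℓ : (Fin d → ℝ) → Z → ℝ) (hℓ0 : ∀ θ z, 0 ≤ ℓ θ z)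
    (L lam : ℝ) (hL : 0 < L) (hlam : 0 < lam)
    (hconv : ∀ z, ConvexOn ℝ Set.univ fun θ => ℓ θ z)
    (hlip : ∀ z θ θ', |ℓ θ z - ℓ θ' z| ≤ L * Real.sqrt (∑ i, (θ i - θ' i) ^ 2))
    (θhat : (Fin n → Z) → Fin d → ℝ) (hθhatm : Measurable θhat)
    (hθhat : ∀ S θ,
      (1 / (n : ℝ)) * ∑ i, ℓ (θhat S) (S i) + lam * ∑ j, (θhat S j) ^ 2
        ≤ (1 / (n : ℝ)) * ∑ i, ℓ θ (S i) + lam * ∑ j, (θ j) ^ 2)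
    (δ : ℝ) (hδ : δ ∈ Set.Ioo (0 : ℝ) 1) :
    ENNReal.ofReal (1 - δ) ≤
      (Measure.pi fun _ : Fin n => D)
        {S | Real.sqrt (∑ j, (θhat S j
              - ∫ S', θhat S' j ∂(Measure.pi fun _ : Fin n => D)) ^ 2)
            < (L / lam) * Real.sqrt (2 * Real.log (2 / δ) / (n : ℝ))} := by
  obtain ⟨hδ0, hδ1⟩ := hδ
  have hn0 : (0 : ℝ) < n := by exact_mod_cast hn
  let P : Measure (Fin n → Z) := Measure.pi fun _ => D
  let l : EuclideanSpace ℝ (Fin d) → Z → ℝ := fun x z => ℓ x.ofLp z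
  let h : (Fin n → Z) → EuclideanSpace ℝ (Fin d) := fun S => WithLp.toLp 2 (θhat S)
  have hlipE : ∀ z x y, |l x z - l y z| ≤ L * ‖x - y‖ := fun z x y => by
    simpa [EuclideanSpace.norm_eq] using hlip z x.ofLp y.ofLp
  have hconvE : ∀ z, ConvexOn ℝ Set.univ fun x => l x z := fun z =>
    ⟨convex_univ, fun x _ y _ a b ha hb hab => by
      simpa [l] using (hconv z).2 (Set.mem_univ x.ofLp) (Set.mem_univ y.ofLp) ha hb hab⟩
  have hminE : ∀ S x, (1 / (n : ℝ)) * ∑ i, l (h S) (S i) + lam * ‖h S‖ ^ 2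
      ≤ (1 / (n : ℝ)) * ∑ i, l x (S i) + lam * ‖x‖ ^ 2 := fun S x => by
    simpa [l, h, EuclideanSpace.norm_sq_eq] using hθhat S x.ofLp
  have hmeas : StronglyMeasurable h :=
    ((WithLp.measurable_toLp 2 (Fin d → ℝ)).comp hθhatm).stronglyMeasurable
  have hbound := norm_regularizedMinimizer_le hn hL hlam hlipE hminE
  have hint : Integrable h P :=
    .of_bound hmeas.aestronglyMeasurable _ (.of_forall hbound)
  have hcoord : ∀ j, (∫ S, h S ∂P) j = ∫ S, θhat S j ∂P := fun j =>
    eval_integral_piLp (fun j => hint.eval_piLp j) j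
  let r : ℝ := (L / lam) * sqrt (2 * log (2 / δ) / n)
  have hlog : 0 < log (2 / δ) := log_pos (by rw [lt_div_iff₀ hδ0]; linarith)
  have hr : 0 < r := by positivity
  have htail := measureReal_norm_sub_integral_ge_le D (c := L / (lam * n)) (by positivity) hn
    hmeas hbound (norm_regularizedMinimizer_sub_le hn hL hlam hconvE hlipE hminE) hr
  have hexponent : -r ^ 2 / (2 * n * (L / (lam * n)) ^ 2) = -log (2 / δ) := by
    simp only [r]
    rw [mul_pow, sq_sqrt (by positivity)]
    field_simp
  rw [hexponent, exp_neg, exp_log (by positivity), inv_div, mul_div_cancel₀ _ two_ne_zero] at htail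
  have hset : {S | sqrt (∑ j, (θhat S j - ∫ S', θhat S' j ∂P) ^ 2) < r}
      = {S | r ≤ ‖h S - ∫ S', h S' ∂P‖}ᶜ := by
    ext S
    simp [EuclideanSpace.norm_eq, hcoord, h]
  have hsetm : MeasurableSet {S | r ≤ ‖h S - ∫ S', h S' ∂P‖} :=
    measurableSet_le measurable_const (hmeas.sub stronglyMeasurable_const).norm.measurable
  change ENNReal.ofReal (1 - δ) ≤ P {S | sqrt (∑ j, (θhat S j - ∫ S', θhat S' j ∂P) ^ 2) < r}
  rw [hset, ← ofReal_measureReal, probReal_compl_eq_one_sub hsetm]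
  exact ENNReal.ofReal_le_ofReal (sub_le_sub_left htail 1)
end
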